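/- arXiv:2104.10426 — 7 statements merged into one kernel-verified Lean document; each statement's English description precedes it below -/
import Mathlib

section
/- Suppose the nominal load satisfies ρ_i < 1 for every i ∈ {1,…,N}. Then there exists δ > 0, depending only on N, λ, the μ_i, τ_i, the vectors p₀, p₁ and the joint distribution of (η₁, η₂), such that every reduced fluid solution whose total initial mass Σ_i ( Q̄_{c,i}(0) + Q̄_{u,i}(0) + Σ_j Q̄_{j,i}(0) ) is at most 1 satisfies Q̄_{c,i}(t) = Q̄_{u,i}(t) = Q̄_{j,i}(t) = 0 for all t ≥ δ and all i, j ∈ {1,…,N}. -/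
open MeasureTheory Set

/-- The data of a speculative queueing network: a probability space carrying the
service requirements `η₁, η₂`, arrival rate `lam`, service rates `μ`, timeouts `τ`,
and routing probability vectors `p0, p1`. -/
structure SpecModel (N : ℕ) (Ω : Type*) [MeasurableSpace Ω] where
  P : Measure Ω
  probP : IsProbabilityMeasure P
  η₁ : Ω → ℝ
  η₂ : Ω → ℝ
  meas₁ : Measurable η₁
  meas₂ : Measurable η₂
  int₁ : Integrable η₁ P
  int₂ : Integrable η₂ P
  nonneg₁ : ∀ ω, 0 ≤ η₁ ω
  nonneg₂ : ∀ ω, 0 ≤ η₂ ω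
  lam : ℝ
  lam_pos : 0 < lam
  μ : Fin N → ℝ
  μ_pos : ∀ i, 0 < μ i
  τ : Fin N → ℝ
  τ_pos : ∀ i, 0 < τ i
  p0 : Fin N → ℝ
  p1 : Fin N → ℝ
  p0_nonneg : ∀ i, 0 ≤ p0 i
  p0_sum : ∑ i, p0 i = 1
  p1_pos : ∀ i, 0 < p1 i
  p1_sum : ∑ i, p1 i = 1
  q_pos : ∀ i, 0 < (P {ω | η₁ ω ≤ μ i * τ i}).toReal
  q_lt_one : ∀ i, (P {ω | η₁ ω ≤ μ i * τ i}).toReal < 1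

namespace SpecModel

variable {N : ℕ} {Ω : Type*} [MeasurableSpace Ω]

/-- `q i = P(η₁ ≤ μ i τ i)`. -/
noncomputable def q (M : SpecModel N Ω) (i : Fin N) : ℝ :=
  (M.P {ω | M.η₁ ω ≤ M.μ i * M.τ i}).toReal

/-- `mc i = E[(η₁/μ i)·1{η₁ ≤ μ i τ i}] / q i`. -/
noncomputable def mc (M : SpecModel N Ω) (i : Fin N) : ℝ :=
  (∫ ω in {ω | M.η₁ ω ≤ M.μ i * M.τ i}, M.η₁ ω / M.μ i ∂M.P) / M.q i

/-- `mm j i = E[(η₂/μ i)·1{η₁ > μ j τ j}] / (1 - q j)`. -/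
noncomputable def mm (M : SpecModel N Ω) (j i : Fin N) : ℝ :=
  (∫ ω in {ω | M.μ j * M.τ j < M.η₁ ω}, M.η₂ ω / M.μ i ∂M.P) / (1 - M.q j)

/-- Nominal load of queue `i`. -/
noncomputable def rho (M : SpecModel N Ω) (i : Fin N) : ℝ :=
  M.lam * N * M.p0 i * (∫ ω, min (M.η₁ ω / M.μ i) (M.τ i) ∂M.P)
    + M.lam * N * ∑ j, M.p0 j * M.p1 i *
        (∫ ω in {ω | M.μ j * M.τ j < M.η₁ ω}, M.η₂ ω / M.μ i ∂M.P)

/-- A reduced fluid solution of the speculative queueing network. -/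
structure FluidSol (M : SpecModel N Ω) where
  Qc : Fin N → ℝ → ℝ
  Qu : Fin N → ℝ → ℝ
  Qm : Fin N → Fin N → ℝ → ℝ
  Tc : Fin N → ℝ → ℝ
  Tu : Fin N → ℝ → ℝ
  Tm : Fin N → Fin N → ℝ → ℝ
  Qc_nonneg : ∀ i t, 0 ≤ t → 0 ≤ Qc i t
  Qu_nonneg : ∀ i t, 0 ≤ t → 0 ≤ Qu i t
  Qm_nonneg : ∀ j i t, 0 ≤ t → 0 ≤ Qm j i t
  Tc_mono : ∀ i, MonotoneOn (Tc i) (Ici 0)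
  Tu_mono : ∀ i, MonotoneOn (Tu i) (Ici 0)
  Tm_mono : ∀ j i, MonotoneOn (Tm j i) (Ici 0)
  Tc_zero : ∀ i, Tc i 0 = 0
  Tu_zero : ∀ i, Tu i 0 = 0
  Tm_zero : ∀ j i, Tm j i 0 = 0
  Tc_nonneg : ∀ i t, 0 ≤ t → 0 ≤ Tc i t
  Tu_nonneg : ∀ i t, 0 ≤ t → 0 ≤ Tu i t
  Tm_nonneg : ∀ j i t, 0 ≤ t → 0 ≤ Tm j i t
  eq_c : ∀ i t, 0 ≤ t →
    Qc i t = Qc i 0 + M.lam * N * M.p0 i * M.q i * t - Tc i t / M.mc i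
  eq_u : ∀ i t, 0 ≤ t →
    Qu i t = Qu i 0 + M.lam * N * M.p0 i * (1 - M.q i) * t - Tu i t / M.τ i
  eq_m : ∀ j i t, 0 ≤ t →
    Qm j i t = Qm j i 0 - Tm j i t / M.mm j i + M.p1 i * Tu j t / M.τ j
  idle_mono : ∀ i, MonotoneOn
    (fun t => t - Tc i t - Tu i t - ∑ j, Tm j i t) (Ici 0)
  work_conserving : ∀ i a b, 0 ≤ a → a ≤ b →
    (∀ t ∈ Icc a b, 0 < Qc i t + Qu i t + ∑ j, Qm j i t) →
    (b - Tc i b - Tu i b - ∑ j, Tm j i b) = (a - Tc i a - Tu i a - ∑ j, Tm j i a)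

end SpecModel

namespace SpecModel

variable {N : ℕ} {Ω : Type*} [MeasurableSpace Ω]

noncomputable def auxL (M : SpecModel N Ω) (j : Fin N) : ℝ :=
  (∫ ω in {ω | M.μ j * M.τ j < M.η₁ ω}, M.η₂ ω ∂M.P) / (1 - M.q j)

theorem aux_mm (M : SpecModel N Ω) (j i : Fin N) : M.mm j i = M.auxL j / M.μ i := by
  unfold mm auxL
  rw [integral_div]
  ring

theorem aux_one_sub_q (M : SpecModel N Ω) (i : Fin N) : 0 < 1 - M.q i := by
  have := M.q_lt_one i
  unfold q; linarith

theorem aux_q_pos (M : SpecModel N Ω) (i : Fin N) : 0 < M.q i := M.q_pos i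

theorem aux_min (M : SpecModel N Ω) (i : Fin N) :
    ∫ ω, min (M.η₁ ω / M.μ i) (M.τ i) ∂M.P = M.mc i * M.q i + M.τ i * (1 - M.q i) := by
  haveI := M.probP
  have hμ := M.μ_pos i
  have hA : MeasurableSet {ω | M.η₁ ω ≤ M.μ i * M.τ i} := measurableSet_le M.meas₁ measurable_const
  have hint : Integrable (fun ω => min (M.η₁ ω / M.μ i) (M.τ i)) M.P :=
    (M.int₁.div_const _).inf (integrable_const _)
  rw [← integral_add_compl hA hint]
  congr 1
  · unfold mc
    rw [div_mul_cancel₀ _ (M.aux_q_pos i).ne']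
    apply setIntegral_congr_fun hA
    intro ω hω
    apply min_eq_left
    rw [div_le_iff₀ hμ]
    have : M.η₁ ω ≤ M.μ i * M.τ i := hω
    linarith
  · have h1 : ∫ ω in {ω | M.η₁ ω ≤ M.μ i * M.τ i}ᶜ, min (M.η₁ ω / M.μ i) (M.τ i) ∂M.P
        = ∫ ω in {ω | M.η₁ ω ≤ M.μ i * M.τ i}ᶜ, M.τ i ∂M.P := by
      apply setIntegral_congr_fun hA.compl
      intro ω hω
      apply min_eq_right
      rw [le_div_iff₀ hμ]
      have : ¬ M.η₁ ω ≤ M.μ i * M.τ i := hω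
      linarith
    rw [h1, setIntegral_const, probReal_compl_eq_one_sub hA]
    simp [q, Measure.real, mul_comm]

theorem aux_rho (M : SpecModel N Ω) (i : Fin N) :
    M.rho i = M.lam * N * M.p0 i * (M.mc i * M.q i + M.τ i * (1 - M.q i))
      + ∑ j, M.lam * N * M.p0 j * (1 - M.q j) * M.p1 i * M.mm j i := by
  unfold rho
  rw [aux_min, Finset.mul_sum]
  congr 1
  apply Finset.sum_congr rfl
  intro j _
  have := (M.aux_one_sub_q j).ne'
  unfold mm
  field_simp

namespace FluidSol

variable {M : SpecModel N Ω}

noncomputable def idle (F : FluidSol M) (i : Fin N) (t : ℝ) : ℝ :=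
  t - F.Tc i t - F.Tu i t - ∑ j, F.Tm j i t

noncomputable def tot (F : FluidSol M) (i : Fin N) (t : ℝ) : ℝ :=
  F.Qc i t + F.Qu i t + ∑ j, F.Qm j i t

noncomputable def V (F : FluidSol M) (i : Fin N) (t : ℝ) : ℝ :=
  M.μ i / M.p1 i * (M.mc i * F.Qc i t + M.τ i * F.Qu i t + ∑ j, M.mm j i * F.Qm j i t)
    + ∑ j, M.auxL j * F.Qu j t

theorem V_eq (F : FluidSol M) (hmc : ∀ i, 0 < M.mc i) (hmm : ∀ j i, 0 < M.mm j i)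
    (i : Fin N) (t : ℝ) (ht : 0 ≤ t) :
    F.V i t = F.V i 0 + M.μ i / M.p1 i * ((M.rho i - 1) * t + F.idle i t) := by
  have hμ := (M.μ_pos i).ne'
  have hp := (M.p1_pos i).ne'
  have hL : ∀ j, M.auxL j = M.μ i * M.mm j i := by
    intro j; rw [aux_mm]; field_simp
  have e1 : M.mc i * F.Qc i t = M.mc i * F.Qc i 0
      + M.lam * N * M.p0 i * (M.mc i * M.q i) * t - F.Tc i t := by
    rw [F.eq_c i t ht]
    have := (hmc i).ne'
    field_simp
  have e2 : M.τ i * F.Qu i t = M.τ i * F.Qu i 0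
      + M.lam * N * M.p0 i * (M.τ i * (1 - M.q i)) * t - F.Tu i t := by
    rw [F.eq_u i t ht]
    have := (M.τ_pos i).ne'
    field_simp
  have e3 : ∑ j, M.mm j i * F.Qm j i t = ∑ j, M.mm j i * F.Qm j i 0 - ∑ j, F.Tm j i t
      + M.p1 i * ∑ j, M.mm j i * (F.Tu j t / M.τ j) := by
    rw [Finset.mul_sum, ← Finset.sum_sub_distrib, ← Finset.sum_add_distrib]
    apply Finset.sum_congr rfl
    intro j _
    rw [F.eq_m j i t ht]
    have := (hmm j i).ne'
    have := (M.τ_pos j).ne'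
    field_simp
  have e4 : ∑ j, M.auxL j * F.Qu j t = ∑ j, M.auxL j * F.Qu j 0
      + M.μ i / M.p1 i * (∑ j, M.lam * N * M.p0 j * (1 - M.q j) * M.p1 i * M.mm j i) * t
      - M.μ i * ∑ j, M.mm j i * (F.Tu j t / M.τ j) := by
    rw [Finset.mul_sum, Finset.mul_sum, Finset.sum_mul, ← Finset.sum_add_distrib,
      ← Finset.sum_sub_distrib]
    apply Finset.sum_congr rfl
    intro j _
    rw [F.eq_u j t ht, hL]
    field_simp
  unfold V idle
  rw [e1, e2, e3, e4, aux_rho]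
  field_simp
  ring

theorem T_lip (F : FluidSol M) (i : Fin N) {s t : ℝ} (hs : 0 ≤ s) (hst : s ≤ t) :
    F.Tc i t - F.Tc i s ≤ t - s ∧ F.Tu i t - F.Tu i s ≤ t - s ∧
    (∀ j, F.Tm j i t - F.Tm j i s ≤ t - s) := by
  have ht : 0 ≤ t := hs.trans hst
  have h0 := F.idle_mono i (mem_Ici.2 hs) (mem_Ici.2 ht) hst
  have h1 := F.Tc_mono i (mem_Ici.2 hs) (mem_Ici.2 ht) hst
  have h2 := F.Tu_mono i (mem_Ici.2 hs) (mem_Ici.2 ht) hst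
  have h3 := fun j => F.Tm_mono j i (mem_Ici.2 hs) (mem_Ici.2 ht) hst
  have h4 : ∑ j, F.Tm j i s ≤ ∑ j, F.Tm j i t := Finset.sum_le_sum (fun j _ => h3 j)
  simp only at h0
  refine ⟨by linarith, by linarith, fun j => ?_⟩
  have h5 : F.Tm j i t - F.Tm j i s ≤ ∑ j, (F.Tm j i t - F.Tm j i s) :=
    Finset.single_le_sum (f := fun j => F.Tm j i t - F.Tm j i s)
      (fun k _ => sub_nonneg.2 (h3 k)) (Finset.mem_univ j)
  rw [Finset.sum_sub_distrib] at h5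
  linarith

theorem cont_of_lip {f : ℝ → ℝ} (hm : MonotoneOn f (Ici 0))
    (h : ∀ s t, 0 ≤ s → s ≤ t → f t - f s ≤ t - s) : ContinuousOn f (Ici 0) := by
  have : LipschitzOnWith 1 f (Ici 0) := by
    apply LipschitzOnWith.of_dist_le_mul
    intro x hx y hy
    rw [Real.dist_eq, Real.dist_eq, NNReal.coe_one, one_mul]
    rcases le_total x y with hxy | hxy
    · have h1 := hm hx hy hxy
      have h2 := h x y hx hxy
      rw [abs_sub_comm, abs_of_nonneg (by linarith), abs_sub_comm, abs_of_nonneg (by linarith)]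
      exact h2
    · have h1 := hm hy hx hxy
      have h2 := h y x hy hxy
      rw [abs_of_nonneg (by linarith), abs_of_nonneg (by linarith)]
      exact h2
  exact this.continuousOn

theorem cont_Qc (F : FluidSol M) (i : Fin N) : ContinuousOn (F.Qc i) (Ici 0) := by
  have := cont_of_lip (F.Tc_mono i) (fun s t hs hst => (F.T_lip i hs hst).1)
  refine ContinuousOn.congr ?_ (fun t ht => F.eq_c i t ht)
  fun_prop

theorem cont_Tu (F : FluidSol M) (i : Fin N) : ContinuousOn (F.Tu i) (Ici 0) :=
  cont_of_lip (F.Tu_mono i) (fun s t hs hst => (F.T_lip i hs hst).2.1)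

theorem cont_Qu (F : FluidSol M) (i : Fin N) : ContinuousOn (F.Qu i) (Ici 0) := by
  have := F.cont_Tu i
  refine ContinuousOn.congr ?_ (fun t ht => F.eq_u i t ht)
  fun_prop

theorem cont_Qm (F : FluidSol M) (j i : Fin N) : ContinuousOn (F.Qm j i) (Ici 0) := by
  have := F.cont_Tu j
  have := cont_of_lip (F.Tm_mono j i) (fun s t hs hst => (F.T_lip i hs hst).2.2 j)
  refine ContinuousOn.congr ?_ (fun t ht => F.eq_m j i t ht)
  fun_prop

theorem cont_tot (F : FluidSol M) (i : Fin N) : ContinuousOn (F.tot i) (Ici 0) := by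
  have h1 := F.cont_Qc i
  have h2 := F.cont_Qu i
  have h3 := fun j => F.cont_Qm j i
  unfold tot
  fun_prop

theorem cont_V (F : FluidSol M) (i : Fin N) : ContinuousOn (F.V i) (Ici 0) := by
  have h1 := F.cont_Qc i
  have h2 := F.cont_Qu
  have h3 := fun j => F.cont_Qm j i
  have h4 := h2 i
  unfold V
  fun_prop

/-- local workload part -/
theorem V_ge (F : FluidSol M) (hmc : ∀ i, 0 < M.mc i) (hmm : ∀ j i, 0 < M.mm j i)
    (i : Fin N) (t : ℝ) (ht : 0 ≤ t) {b : ℝ}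
    (h : F.V i t ≤ ∑ j, M.auxL j * F.Qu j t) :
    F.Qc i t = 0 ∧ F.Qu i t = 0 ∧ ∀ j, F.Qm j i t = 0 := by
  have hk : 0 < M.μ i / M.p1 i := div_pos (M.μ_pos i) (M.p1_pos i)
  have h1 := mul_nonneg (hmc i).le (F.Qc_nonneg i t ht)
  have h2 := mul_nonneg (M.τ_pos i).le (F.Qu_nonneg i t ht)
  have h3 := fun j => mul_nonneg (hmm j i).le (F.Qm_nonneg j i t ht)
  have h4 : 0 ≤ ∑ j, M.mm j i * F.Qm j i t := Finset.sum_nonneg (fun j _ => h3 j)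
  unfold V at h
  have h5 : M.mc i * F.Qc i t + M.τ i * F.Qu i t + ∑ j, M.mm j i * F.Qm j i t ≤ 0 := by
    by_contra hc
    have := mul_pos hk (not_le.1 hc)
    linarith
  refine ⟨?_, ?_, fun j => ?_⟩
  · have : M.mc i * F.Qc i t = 0 := by linarith
    exact (mul_eq_zero.1 this).resolve_left (hmc i).ne'
  · have : M.τ i * F.Qu i t = 0 := by linarith
    exact (mul_eq_zero.1 this).resolve_left (M.τ_pos i).ne'
  · have h6 := Finset.single_le_sum (f := fun j => M.mm j i * F.Qm j i t)
      (fun k _ => h3 k) (Finset.mem_univ j)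
    have : M.mm j i * F.Qm j i t = 0 := le_antisymm (by linarith) (h3 j)
    exact (mul_eq_zero.1 this).resolve_left (hmm j i).ne'

theorem V_of_empty (F : FluidSol M) (i : Fin N) (t : ℝ) (ht : 0 ≤ t) (h : ¬ 0 < F.tot i t) :
    F.V i t = ∑ j, M.auxL j * F.Qu j t := by
  have h1 := F.Qc_nonneg i t ht
  have h2 := F.Qu_nonneg i t ht
  have h3 := fun j => F.Qm_nonneg j i t ht
  have h4 : 0 ≤ ∑ j, F.Qm j i t := Finset.sum_nonneg (fun j _ => h3 j)
  unfold tot at h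
  have h5 : ∑ j, F.Qm j i t = 0 := by linarith
  have h6 := (Finset.sum_eq_zero_iff_of_nonneg (fun j _ => h3 j)).1 h5
  unfold V
  rw [show F.Qc i t = 0 by linarith, show F.Qu i t = 0 by linarith,
    Finset.sum_eq_zero (s := Finset.univ) (f := fun j => M.mm j i * F.Qm j i t)
      (fun j hj => by rw [h6 j hj, mul_zero])]
  simp

theorem V_bound (F : FluidSol M) (hmc : ∀ i, 0 < M.mc i) (hmm : ∀ j i, 0 < M.mm j i)
    {ε C κ : ℝ} (hε : 0 < ε) (hκ : 0 < κ)
    (hεi : ∀ i, ε ≤ M.μ i / M.p1 i * (1 - M.rho i))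
    (hC : ∀ i, F.V i 0 ≤ C) (T : ℝ) (hT : 0 ≤ T) (i : Fin N) :
    F.V i T ≤ max (C - ε * T) κ := by
  have hsub : Icc 0 T ⊆ {t | ∀ i, F.V i t ≤ max (C - ε * t) κ} := by
    apply IsClosed.Icc_subset_of_forall_mem_nhdsWithin
    · have : {t | ∀ i, F.V i t ≤ max (C - ε * t) κ} ∩ Icc 0 T
          = Icc 0 T ∩ ⋂ i, {t | t ∈ Icc 0 T ∧ F.V i t ≤ max (C - ε * t) κ} := by
        ext t
        simp only [mem_inter_iff, mem_setOf_eq, mem_iInter]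
        constructor
        · rintro ⟨h1, h2⟩
          exact ⟨h2, fun i => ⟨h2, h1 i⟩⟩
        · rintro ⟨h1, h2⟩
          exact ⟨fun i => (h2 i).2, h1⟩
      rw [this]
      refine isClosed_Icc.inter (isClosed_iInter fun i => ?_)
      exact IsClosed.isClosed_le isClosed_Icc ((F.cont_V i).mono (fun t ht => ht.1))
        (by fun_prop)
    · intro i
      exact (hC i).trans (by simp)
    · rintro t ⟨hS, ht0, htT⟩
      have hS' : ∀ i, F.V i t ≤ max (C - ε * t) κ := hS
      change ∀ᶠ s in nhdsWithin t (Ioi t), ∀ i, F.V i s ≤ max (C - ε * s) κ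
      rw [Filter.eventually_all]
      intro i
      have hsubI : Ioi t ⊆ Ici 0 := fun s hs => ht0.trans (le_of_lt hs)
      by_cases hlt : F.V i t < max (C - ε * t) κ
      · have c1 : Filter.Tendsto (F.V i) (nhdsWithin t (Ioi t)) (nhds (F.V i t)) :=
          ((F.cont_V i) t ht0).mono hsubI
        have c2 : Filter.Tendsto (fun s => max (C - ε * s) κ) (nhdsWithin t (Ioi t))
            (nhds (max (C - ε * t) κ)) :=
          (Continuous.continuousWithinAt (by fun_prop))
        filter_upwards [c1.eventually_lt c2 hlt] with s hs using hs.le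
      · have heq : F.V i t = max (C - ε * t) κ := le_antisymm (hS' i) (not_lt.1 hlt)
        have hne : 0 < F.tot i t := by
          by_contra hc
          have hV := F.V_of_empty i t ht0 hc
          have hz : ∀ k, F.Qu k t = 0 := fun k =>
            (F.V_ge (b := 0) hmc hmm k t ht0 (by rw [← hV, heq]; exact hS' k)).2.1
          rw [Finset.sum_eq_zero (fun j _ => by rw [hz j, mul_zero])] at hV
          have := le_max_right (C - ε * t) κ
          linarith
        have hnh : {s | 0 < F.tot i s} ∈ nhdsWithin t (Ici t) := by
          have c1 : Filter.Tendsto (F.tot i) (nhdsWithin t (Ici t)) (nhds (F.tot i t)) :=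
            ((F.cont_tot i) t ht0).mono (fun s hs => ht0.trans hs)
          exact c1.eventually (lt_mem_nhds hne)
        obtain ⟨u, hu, hus⟩ := mem_nhdsGE_iff_exists_Icc_subset.1 hnh
        filter_upwards [Ioc_mem_nhdsGT hu] with s hs
        have hts := hs.1.le
        have hI : F.idle i s = F.idle i t :=
          F.work_conserving i t s ht0 hts (fun r hr => hus ⟨hr.1, hr.2.trans hs.2⟩)
        have e1 := F.V_eq hmc hmm i t ht0
        have e2 := F.V_eq hmc hmm i s (ht0.trans hts)
        rw [hI] at e2
        have e3 : F.V i s = F.V i t - M.μ i / M.p1 i * (1 - M.rho i) * (s - t) := by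
          rw [e1, e2]; ring
        have e4 := mul_le_mul_of_nonneg_right (hεi i) (sub_nonneg.2 hts)
        have e5 : 0 ≤ ε * (s - t) := mul_nonneg hε.le (sub_nonneg.2 hts)
        rcases max_cases (C - ε * t) κ with ⟨h, _⟩ | ⟨h, _⟩
        · apply le_max_of_le_left
          linarith
        · apply le_max_of_le_right
          linarith
  exact hsub ⟨hT, le_rfl⟩ i

theorem V_init (F : FluidSol M) (hmc : ∀ i, 0 < M.mc i) (hmm : ∀ j i, 0 < M.mm j i)
    (hL : ∀ j, 0 < M.auxL j)
    (h : (∑ i, (F.Qc i 0 + F.Qu i 0 + ∑ j, F.Qm j i 0)) ≤ 1) (i : Fin N) :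
    F.V i 0 ≤ M.μ i / M.p1 i * (M.mc i + M.τ i + ∑ j, M.mm j i) + ∑ j, M.auxL j := by
  have hk : 0 < M.μ i / M.p1 i := div_pos (M.μ_pos i) (M.p1_pos i)
  have a1 := fun i => F.Qc_nonneg i 0 le_rfl
  have a2 := fun i => F.Qu_nonneg i 0 le_rfl
  have a3 := fun j i => F.Qm_nonneg j i 0 le_rfl
  have a4 : ∀ i, 0 ≤ ∑ j, F.Qm j i 0 := fun i => Finset.sum_nonneg (fun j _ => a3 j i)
  have hi : ∀ i, F.Qc i 0 + F.Qu i 0 + ∑ j, F.Qm j i 0 ≤ 1 := fun i =>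
    (Finset.single_le_sum (f := fun i => F.Qc i 0 + F.Qu i 0 + ∑ j, F.Qm j i 0)
      (fun k _ => by have := a1 k; have := a2 k; have := a4 k; positivity)
      (Finset.mem_univ i)).trans h
  have b1 : ∀ i, F.Qc i 0 ≤ 1 := fun i => by linarith [hi i, a1 i, a2 i, a4 i]
  have b2 : ∀ i, F.Qu i 0 ≤ 1 := fun i => by linarith [hi i, a1 i, a2 i, a4 i]
  have b3 : ∀ j i, F.Qm j i 0 ≤ 1 := fun j i => by
    have := Finset.single_le_sum (f := fun j => F.Qm j i 0) (fun k _ => a3 k i)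
      (Finset.mem_univ j)
    linarith [hi i, a1 i, a2 i]
  unfold V
  have c1 := mul_le_of_le_one_right (hmc i).le (b1 i)
  have c2 := mul_le_of_le_one_right (M.τ_pos i).le (b2 i)
  have c3 : ∑ j, M.mm j i * F.Qm j i 0 ≤ ∑ j, M.mm j i :=
    Finset.sum_le_sum (fun j _ => mul_le_of_le_one_right (hmm j i).le (b3 j i))
  have c4 : ∑ j, M.auxL j * F.Qu j 0 ≤ ∑ j, M.auxL j :=
    Finset.sum_le_sum (fun j _ => mul_le_of_le_one_right (hL j).le (b2 j))
  have c5 := mul_le_mul_of_nonneg_left (add_le_add (add_le_add c1 c2) c3) hk.le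
  linarith

end FluidSol

theorem aux_eps {N : ℕ} (f : Fin N → ℝ) (hf : ∀ i, 0 < f i) : ∃ ε > 0, ∀ i, ε ≤ f i := by
  rcases isEmpty_or_nonempty (Fin N) with h | h
  · exact ⟨1, one_pos, fun i => h.elim i⟩
  · obtain ⟨k, hk⟩ := Finite.exists_min f
    exact ⟨f k, hf k, hk⟩

end SpecModel

open SpecModel

/-- **fluid stability, Theorem 1.** If the nominal load satisfies `ρ_i < 1`
for every queue `i`, then there is a `δ > 0` (depending only on the model data) such that
every reduced fluid solution with total initial mass at most `1` is identically zero from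
time `δ` on. -/
theorem fluid_stability {N : ℕ} {Ω : Type*} [MeasurableSpace Ω]
    (M : SpecModel N Ω)
    (hmc : ∀ i, 0 < M.mc i) (hmm : ∀ j i, 0 < M.mm j i)
    (hρ : ∀ i, M.rho i < 1) :
    ∃ δ > (0 : ℝ), ∀ F : SpecModel.FluidSol M,
      (∑ i, (F.Qc i 0 + F.Qu i 0 + ∑ j, F.Qm j i 0)) ≤ 1 →
      ∀ t, δ ≤ t → ∀ i j, F.Qc i t = 0 ∧ F.Qu i t = 0 ∧ F.Qm j i t = 0 := by
  have hk : ∀ i, 0 < M.μ i / M.p1 i := fun i => div_pos (M.μ_pos i) (M.p1_pos i)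
  have hL : ∀ j, 0 < M.auxL j := fun j => by
    have := hmm j j
    rw [aux_mm] at this
    exact (div_pos_iff_of_pos_right (M.μ_pos j)).1 this
  obtain ⟨ε, hε, hεi⟩ := aux_eps (fun i => M.μ i / M.p1 i * (1 - M.rho i))
    (fun i => mul_pos (hk i) (sub_pos.2 (hρ i)))
  let Ci : Fin N → ℝ := fun i =>
    M.μ i / M.p1 i * (M.mc i + M.τ i + ∑ j, M.mm j i) + ∑ j, M.auxL j
  have hCi : ∀ i, 0 ≤ Ci i := fun i => by
    have h1 : 0 ≤ ∑ j, M.mm j i := Finset.sum_nonneg (fun j _ => (hmm j i).le)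
    have h2 : 0 ≤ ∑ j, M.auxL j := Finset.sum_nonneg (fun j _ => (hL j).le)
    have h3 := hmc i
    have h4 := M.τ_pos i
    have h5 := hk i
    exact add_nonneg (mul_nonneg h5.le (by linarith)) h2
  have hC0 : 0 ≤ ∑ i, Ci i := Finset.sum_nonneg (fun i _ => hCi i)
  refine ⟨(∑ i, Ci i) / ε + 1, by positivity, ?_⟩
  intro F hF t ht i j
  have hd : 0 ≤ (∑ i, Ci i) / ε := by positivity
  have ht0 : 0 ≤ t := by linarith
  have hCt : (∑ i, Ci i) - ε * t ≤ 0 := by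
    have : (∑ i, Ci i) / ε ≤ t := by linarith
    rw [div_le_iff₀ hε] at this
    linarith
  have hinit : ∀ i, F.V i 0 ≤ ∑ i, Ci i := fun i =>
    (F.V_init hmc hmm hL hF i).trans
      (Finset.single_le_sum (f := Ci) (fun k _ => hCi k) (Finset.mem_univ i))
  have hV : F.V i t ≤ 0 := by
    apply le_of_forall_pos_le_add
    intro κ hκ
    have := F.V_bound hmc hmm hε hκ hεi hinit t ht0 i
    rw [max_eq_right (by linarith)] at this
    linarith
  have hU : 0 ≤ ∑ j, M.auxL j * F.Qu j t :=
    Finset.sum_nonneg (fun j _ => mul_nonneg (hL j).le (F.Qu_nonneg j t ht0))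
  obtain ⟨h1, h2, h3⟩ := F.V_ge (b := 0) hmc hmm i t ht0 (hV.trans hU)
  exact ⟨h1, h2, h3 j⟩
end

section
/- If all servers have unit speed, then the infimum over τ ∈ [0,∞) of ρ(τ) equals the infimum, taken over all probability vectors p₀ = (p_{0,i})_{i=1}^N and p₁ = (p_{1,i})_{i=1}^N and all timeout vectors (τ₁,…,τ_N) ∈ [0,∞)^N, of max_{1≤i≤N} ρ_i, where ρ_i := λ N p_{0,i} E[min(η₁, τ_i)] + λ N p_{1,i} Σ_{j=1}^N p_{0,j} E[η₂·1{η₁ > τ_j}]. In other words, the worst per-queue nominal load is minimized by taking identical timeouts and uniform routing probabilities. -/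
open MeasureTheory Set

theorem aux_load (A B : ℝ → ℝ) (hA : ∀ t, 0 ≤ t → 0 ≤ A t) (hB : ∀ t, 0 ≤ t → 0 ≤ B t)
    (N : ℕ) (hN : 0 < N) (lam : ℝ) (hlam : 0 < lam) :
    sInf {r : ℝ | ∃ τ : ℝ, 0 ≤ τ ∧ r = lam * (A τ + B τ)}
      = sInf {r : ℝ | ∃ p0 p1 τv : Fin N → ℝ,
          (∀ i, 0 ≤ p0 i) ∧ (∑ i, p0 i) = 1 ∧
          (∀ i, 0 ≤ p1 i) ∧ (∑ i, p1 i) = 1 ∧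
          (∀ i, 0 ≤ τv i) ∧
          r = Finset.univ.sup' ⟨⟨0, hN⟩, Finset.mem_univ _⟩ (fun i =>
            lam * N * p0 i * A (τv i) + lam * N * p1 i * ∑ j, p0 j * B (τv j))} := by
  have hN' : (0 : ℝ) < N := by exact_mod_cast hN
  have hbdd : BddBelow {r : ℝ | ∃ τ : ℝ, 0 ≤ τ ∧ r = lam * (A τ + B τ)} := by
    refine ⟨0, ?_⟩
    rintro r ⟨t, ht, rfl⟩
    exact mul_nonneg hlam.le (add_nonneg (hA t ht) (hB t ht))
  have hlow : ∀ r ∈ {r : ℝ | ∃ p0 p1 τv : Fin N → ℝ,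
          (∀ i, 0 ≤ p0 i) ∧ (∑ i, p0 i) = 1 ∧
          (∀ i, 0 ≤ p1 i) ∧ (∑ i, p1 i) = 1 ∧
          (∀ i, 0 ≤ τv i) ∧
          r = Finset.univ.sup' ⟨⟨0, hN⟩, Finset.mem_univ _⟩ (fun i =>
            lam * N * p0 i * A (τv i) + lam * N * p1 i * ∑ j, p0 j * B (τv j))},
      sInf {r : ℝ | ∃ τ : ℝ, 0 ≤ τ ∧ r = lam * (A τ + B τ)} ≤ r := by
    rintro r ⟨p0, p1, τv, h0, h0s, h1, h1s, ht, hr⟩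
    set m := sInf {r : ℝ | ∃ τ : ℝ, 0 ≤ τ ∧ r = lam * (A τ + B τ)} with hm
    have hle : ∀ i, lam * N * p0 i * A (τv i) + lam * N * p1 i * ∑ j, p0 j * B (τv j) ≤ r := by
      intro i
      rw [hr]
      exact Finset.le_sup' (fun i =>
            lam * N * p0 i * A (τv i) + lam * N * p1 i * ∑ j, p0 j * B (τv j)) (Finset.mem_univ i)
    have hmi : ∀ i, p0 i * m ≤ p0 i * (lam * (A (τv i) + B (τv i))) := fun i =>
      mul_le_mul_of_nonneg_left (csInf_le hbdd ⟨τv i, ht i, rfl⟩) (h0 i)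
    have hsum := Finset.sum_le_sum (fun i (_ : i ∈ Finset.univ) => hle i)
    have hsum2 := Finset.sum_le_sum (fun i (_ : i ∈ Finset.univ) => hmi i)
    rw [← Finset.sum_mul, h0s, one_mul] at hsum2
    have e1 : ∑ i, p0 i * (lam * (A (τv i) + B (τv i)))
        = lam * (∑ i, p0 i * A (τv i) + ∑ i, p0 i * B (τv i)) := by
      rw [← Finset.sum_add_distrib, Finset.mul_sum]
      exact Finset.sum_congr rfl fun i _ => by ring
    have e2 : ∑ i, (lam * N * p0 i * A (τv i) + lam * N * p1 i * ∑ j, p0 j * B (τv j))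
        = N * (lam * (∑ i, p0 i * A (τv i) + ∑ i, p0 i * B (τv i))) := by
      rw [Finset.sum_add_distrib, ← Finset.sum_mul, ← Finset.mul_sum, h1s]
      have : ∑ i, lam * N * p0 i * A (τv i) = lam * N * ∑ i, p0 i * A (τv i) := by
        rw [Finset.mul_sum]
        exact Finset.sum_congr rfl fun i _ => by ring
      rw [this]; ring
    rw [e2] at hsum
    simp only [Finset.sum_const, Finset.card_univ, Fintype.card_fin, nsmul_eq_mul] at hsum
    rw [e1] at hsum2
    exact hsum2.trans (le_of_mul_le_mul_left hsum hN')
  have hsub : ∀ r ∈ {r : ℝ | ∃ τ : ℝ, 0 ≤ τ ∧ r = lam * (A τ + B τ)},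
      r ∈ {r : ℝ | ∃ p0 p1 τv : Fin N → ℝ,
          (∀ i, 0 ≤ p0 i) ∧ (∑ i, p0 i) = 1 ∧
          (∀ i, 0 ≤ p1 i) ∧ (∑ i, p1 i) = 1 ∧
          (∀ i, 0 ≤ τv i) ∧
          r = Finset.univ.sup' ⟨⟨0, hN⟩, Finset.mem_univ _⟩ (fun i =>
            lam * N * p0 i * A (τv i) + lam * N * p1 i * ∑ j, p0 j * B (τv j))} := by
    rintro r ⟨t, ht, rfl⟩
    have hs : ∑ _i : Fin N, (N : ℝ)⁻¹ = 1 := by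
      simp [hN'.ne']
    refine ⟨fun _ => (N : ℝ)⁻¹, fun _ => (N : ℝ)⁻¹, fun _ => t, fun _ => by positivity, hs,
      fun _ => by positivity, hs, fun _ => ht, ?_⟩
    refine Eq.trans ?_ (Finset.sup'_const _ _).symm
    beta_reduce
    rw [← Finset.sum_mul, hs]
    field_simp
  have hne : {r : ℝ | ∃ τ : ℝ, 0 ≤ τ ∧ r = lam * (A τ + B τ)}.Nonempty := ⟨_, 0, le_rfl, rfl⟩
  apply le_antisymm
  · exact le_csInf (hne.mono hsub) hlow
  · exact csInf_le_csInf ⟨_, hlow⟩ hne hsub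

/-- **Proposition 2.** For homogeneous (unit-speed) servers, the infimum over
`τ ≥ 0` of the symmetric nominal load `ρ(τ) = λ(E[min(η₁,τ)] + E[η₂·1{η₁>τ}])` equals the
infimum, over all probability vectors `p₀, p₁` and all timeout vectors `τ ∈ [0,∞)^N`, of
`max_i ρ_i`, where
`ρ_i = λ N p₀ᵢ E[min(η₁, τᵢ)] + λ N p₁ᵢ ∑ⱼ p₀ⱼ E[η₂·1{η₁ > τⱼ}]`. -/
theorem inf_load_symmetric {Ω : Type*} [MeasurableSpace Ω]
    (P : Measure Ω) [IsProbabilityMeasure P]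
    (η₁ η₂ : Ω → ℝ) (hmeas₁ : Measurable η₁) (hmeas₂ : Measurable η₂)
    (hint₁ : Integrable η₁ P) (hint₂ : Integrable η₂ P)
    (hnn₁ : ∀ ω, 0 ≤ η₁ ω) (hnn₂ : ∀ ω, 0 ≤ η₂ ω)
    (N : ℕ) (hN : 0 < N) (lam : ℝ) (hlam : 0 < lam) :
    sInf {r : ℝ | ∃ τ : ℝ, 0 ≤ τ ∧
        r = lam * ((∫ ω, min (η₁ ω) τ ∂P) + ∫ ω in {ω | τ < η₁ ω}, η₂ ω ∂P)}
      = sInf {r : ℝ | ∃ p0 p1 τv : Fin N → ℝ,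
          (∀ i, 0 ≤ p0 i) ∧ (∑ i, p0 i) = 1 ∧
          (∀ i, 0 ≤ p1 i) ∧ (∑ i, p1 i) = 1 ∧
          (∀ i, 0 ≤ τv i) ∧
          r = Finset.univ.sup' ⟨⟨0, hN⟩, Finset.mem_univ _⟩ (fun i =>
            lam * N * p0 i * (∫ ω, min (η₁ ω) (τv i) ∂P)
              + lam * N * p1 i * ∑ j, p0 j * ∫ ω in {ω | τv j < η₁ ω}, η₂ ω ∂P)} := by
  exact aux_load (fun t => ∫ ω, min (η₁ ω) t ∂P) (fun t => ∫ ω in {ω | t < η₁ ω}, η₂ ω ∂P)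
    (fun t ht => integral_nonneg fun ω => le_min (hnn₁ ω) ht)
    (fun t _ => integral_nonneg fun ω => hnn₂ ω) N hN lam hlam
end

section
/- Under the S&X model, let z ≥ 0 be such that for every x with P(X = x) > 0 one has E[min(S₁·x, z)] < P(S₁·x ≤ z)·E[S₁]·x. Then ρ(z) < λ·E[η₁], i.e., speculating with timeout z strictly reduces the nominal load below that of standard load balancing. -/
open MeasureTheory Set ProbabilityTheory

/-- **Theorem 4, sufficiency.** In the S&X model (`η₁ = S₁·X`, `η₂ = S₂·X`
with `S₁, S₂, X` mutually independent, `S₁ ~ S₂`, and `X` countably valued), if `z ≥ 0`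
satisfies `E[min(S₁·x, z)] < P(S₁·x ≤ z)·E[S₁]·x` for every atom `x` of `X`, then
`ρ(z) < λ·E[η₁]`. -/
theorem load_lt_of_capacity_gain {Ω : Type*} [MeasurableSpace Ω]
    (P : Measure Ω) [IsProbabilityMeasure P]
    (S₁ S₂ X : Ω → ℝ)
    (hmS₁ : Measurable S₁) (hmS₂ : Measurable S₂) (hmX : Measurable X)
    (hiS₁ : Integrable S₁ P) (hiS₂ : Integrable S₂ P) (hiX : Integrable X P)
    (hnS₁ : ∀ ω, 0 ≤ S₁ ω) (hnS₂ : ∀ ω, 0 ≤ S₂ ω) (hnX : ∀ ω, 0 ≤ X ω)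
    (hindep : iIndepFun ![S₁, S₂, X] P)
    (hid : IdentDistrib S₁ S₂ P P)
    (hcount : (Set.range X).Countable)
    (lam : ℝ) (hlam : 0 < lam) (z : ℝ) (hz : 0 ≤ z)
    (hgain : ∀ x : ℝ, 0 < (P {ω | X ω = x}).toReal →
      (∫ ω, min (S₁ ω * x) z ∂P)
        < (P {ω | S₁ ω * x ≤ z}).toReal * (∫ ω, S₁ ω ∂P) * x) :
    lam * ((∫ ω, min (S₁ ω * X ω) z ∂P)
        + ∫ ω in {ω | z < S₁ ω * X ω}, S₂ ω * X ω ∂P)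
      < lam * ∫ ω, S₁ ω * X ω ∂P := by
  have hS2 : IndepFun (fun ω => (S₁ ω, X ω)) S₂ P := by
    have h := hindep.indepFun_prodMk (fun i => by fin_cases i <;> simpa) 0 2 1 (by decide) (by decide)
    simpa using h
  have hSX : IndepFun X S₁ P := by
    have h := hindep.indepFun (i := 2) (j := 0) (by decide)
    simpa using h
  set m := ∫ ω, S₁ ω ∂P with hm
  have hm2 : ∫ ω, S₂ ω ∂P = m := hid.integral_eq.symm
  have hmSX : Measurable (fun ω => S₁ ω * X ω) := hmS₁.mul hmX
  have hA : MeasurableSet {ω | S₁ ω * X ω ≤ z} := measurableSet_le hmSX measurable_const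
  have hB : MeasurableSet {ω | z < S₁ ω * X ω} := measurableSet_lt measurable_const hmSX
  have hBA : {ω | z < S₁ ω * X ω} = {ω | S₁ ω * X ω ≤ z}ᶜ := by
    ext ω; simp
  -- E[S₁ X]
  have h1 : ∫ ω, S₁ ω * X ω ∂P = m * ∫ ω, X ω ∂P :=
    hSX.symm.integral_fun_mul_eq_mul_integral hiS₁.aestronglyMeasurable hiX.aestronglyMeasurable
  -- the restart term
  have h2 : ∫ ω in {ω | z < S₁ ω * X ω}, S₂ ω * X ω ∂P
      = m * ∫ ω in {ω | z < S₁ ω * X ω}, X ω ∂P := by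
    rw [← integral_indicator hB, ← integral_indicator hB, ← hm2]
    have hφ : Measurable (fun p : ℝ × ℝ => {p : ℝ × ℝ | z < p.1 * p.2}.indicator (fun p => p.2) p) :=
      measurable_snd.indicator (measurableSet_lt measurable_const (measurable_fst.mul measurable_snd))
    have hi := (hS2.comp hφ measurable_id).symm
    have h := hi.integral_fun_mul_eq_mul_integral hiS₂.aestronglyMeasurable
      (hφ.comp (hmS₁.prodMk hmX)).aestronglyMeasurable
    refine Eq.trans ?_ (h.trans ?_)
    · congr 1; ext ω
      by_cases hω : z < S₁ ω * X ω <;> simp [hω, indicator]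
    · congr 1
  have h3 : ∫ ω, X ω ∂P = (∫ ω in {ω | S₁ ω * X ω ≤ z}, X ω ∂P)
      + ∫ ω in {ω | z < S₁ ω * X ω}, X ω ∂P := by
    rw [hBA]; exact (integral_add_compl hA hiX).symm
  have hmin : ∀ f : Ω → ℝ, Measurable f → (∀ ω, 0 ≤ f ω) →
      Integrable (fun ω => min (f ω) z) P := by
    intro f hf h0
    refine Integrable.of_bound (hf.min measurable_const).aestronglyMeasurable z ?_
    filter_upwards with ω
    rw [Real.norm_of_nonneg (le_min (h0 ω) hz)]
    exact min_le_right _ _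
  have hminI := hmin _ hmSX (fun ω => mul_nonneg (hnS₁ ω) (hnX ω))
  let g : ℝ × ℝ → ℝ := fun p =>
    m * {p : ℝ × ℝ | p.2 * p.1 ≤ z}.indicator (fun p => p.1) p - min (p.2 * p.1) z
  have hg : Measurable g := by
    refine ((measurable_fst.indicator (measurableSet_le (measurable_snd.mul measurable_fst)
      measurable_const)).const_mul m).sub ((measurable_snd.mul measurable_fst).min measurable_const)
  have hgi : ∀ ω, g (X ω, S₁ ω)
      = m * {ω | S₁ ω * X ω ≤ z}.indicator X ω - min (S₁ ω * X ω) z := by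
    intro ω; simp [g, indicator]
  have hgI : Integrable (fun ω => g (X ω, S₁ ω)) P := by
    simp_rw [hgi]
    exact ((hiX.indicator hA).const_mul m).sub hminI
  have hgE : ∫ ω, g (X ω, S₁ ω) ∂P
      = m * (∫ ω in {ω | S₁ ω * X ω ≤ z}, X ω ∂P) - ∫ ω, min (S₁ ω * X ω) z ∂P := by
    simp_rw [hgi]
    rw [integral_sub ((hiX.indicator hA).const_mul m) hminI, integral_const_mul,
      integral_indicator hA]
  have hmap := (indepFun_iff_map_prod_eq_prod_map_map hmX.aemeasurable hmS₁.aemeasurable).1 hSX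
  haveI : IsProbabilityMeasure (P.map X) := Measure.isProbabilityMeasure_map hmX.aemeasurable
  haveI : IsProbabilityMeasure (P.map S₁) := Measure.isProbabilityMeasure_map hmS₁.aemeasurable
  have hgIP : Integrable g ((P.map X).prod (P.map S₁)) := by
    rw [← hmap, integrable_map_measure hg.aestronglyMeasurable (hmX.prodMk hmS₁).aemeasurable]
    exact hgI
  have hgE2 : ∫ ω, g (X ω, S₁ ω) ∂P = ∫ ω, (∫ ω', g (X ω, S₁ ω') ∂P) ∂P := by
    have e1 : ∫ ω, g (X ω, S₁ ω) ∂P = ∫ p, g p ∂((P.map X).prod (P.map S₁)) := by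
      rw [← hmap, integral_map (hmX.prodMk hmS₁).aemeasurable hg.aestronglyMeasurable]
    rw [e1, integral_prod _ hgIP, integral_map hmX.aemeasurable
      hgIP.integral_prod_left.aestronglyMeasurable]
    congr 1; ext ω
    exact (integral_map hmS₁.aemeasurable
      (hg.comp measurable_prodMk_left).aestronglyMeasurable)
  have hHI : Integrable (fun ω => ∫ ω', g (X ω, S₁ ω') ∂P) P := by
    have := (integrable_map_measure hgIP.integral_prod_left.aestronglyMeasurable
      hmX.aemeasurable).1 hgIP.integral_prod_left
    refine this.congr ?_
    filter_upwards with ω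
    simp only [Function.comp]
    exact (integral_map hmS₁.aemeasurable
      (hg.comp measurable_prodMk_left).aestronglyMeasurable)
  have hatom : ∀ᵐ ω ∂P, 0 < (P {ω' | X ω' = X ω}).toReal := by
    have hnull : P (⋃ x ∈ {x ∈ Set.range X | P {ω' | X ω' = x} = 0}, {ω' | X ω' = x}) = 0 := by
      rw [measure_biUnion_null_iff (hcount.mono (fun x hx => hx.1))]
      exact fun x hx => hx.2
    rw [ae_iff]
    refine measure_mono_null ?_ hnull
    intro ω hω
    simp only [mem_setOf_eq, not_lt] at hω
    simp only [mem_iUnion]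
    refine ⟨X ω, ⟨⟨ω, rfl⟩, ?_⟩, rfl⟩
    by_contra hne
    exact absurd (ENNReal.toReal_pos hne (measure_ne_top _ _)) (not_lt.2 hω)
  have hpos : ∀ᵐ ω ∂P, 0 < ∫ ω', g (X ω, S₁ ω') ∂P := by
    filter_upwards [hatom] with ω hω
    have hgω := hgain (X ω) hω
    have hC : MeasurableSet {ω' | S₁ ω' * X ω ≤ z} :=
      measurableSet_le (hmS₁.mul_const _) measurable_const
    have e : ∀ ω', g (X ω, S₁ ω')
        = m * {ω' | S₁ ω' * X ω ≤ z}.indicator (fun _ => X ω) ω' - min (S₁ ω' * X ω) z := by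
      intro ω'; simp [g, indicator]
    simp_rw [e]
    rw [integral_sub (((integrable_const _).indicator hC).const_mul m)
      (hmin _ (hmS₁.mul_const _) (fun ω' => mul_nonneg (hnS₁ ω') (hnX ω))), integral_const_mul,
      integral_indicator hC, setIntegral_const, smul_eq_mul, Measure.real]
    linarith
  have hfin : 0 < ∫ ω, (∫ ω', g (X ω, S₁ ω') ∂P) ∂P := by
    rw [integral_pos_iff_support_of_nonneg_ae (hpos.mono fun ω h => h.le) hHI]
    have : Function.support (fun ω => ∫ ω', g (X ω, S₁ ω') ∂P) =ᵐ[P] Set.univ := by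
      rw [Filter.eventuallyEq_univ]
      exact hpos.mono fun ω h => h.ne'
    rw [measure_congr this]; simp
  rw [← hgE2, hgE] at hfin
  rw [h2, h1, h3]
  apply mul_lt_mul_of_pos_left _ hlam
  linarith
end

section
/- Let F̄(t) := Σ_{i=1}^n p_i·exp(−λ_i·t) for t ≥ 0, where n ≥ 2, p_i > 0 with Σ_i p_i = 1, and λ_i > 0 are not all equal (the complementary CDF of a nondegenerate hyperexponential distribution). Then for every z > 0: ∫_z^∞ F̄(t) dt > F̄(z)·∫_0^∞ F̄(t) dt. Equivalently, a hyperexponentially distributed random variable S satisfies E[min(S, z)] < P(S ≤ z)·E[S] for every z > 0, so every positive timeout satisfies the capacity-gain condition. -/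
open MeasureTheory Set

/-- **hyperexponential slowdown.** Let
`F̄(t) = ∑ i, p i · exp(−λ i · t)` be the complementary CDF of a nondegenerate
hyperexponential distribution (`n ≥ 2`, `p i > 0` summing to `1`, `λ i > 0` not all equal).
Then for every `z > 0`, `∫_z^∞ F̄ > F̄(z) · ∫_0^∞ F̄`; i.e. every positive timeout satisfies
the capacity-gain condition `E[min(S,z)] < P(S ≤ z)·E[S]`. -/
theorem hyperexp_capacity_gain (n : ℕ) (hn : 2 ≤ n)
    (p lam : Fin n → ℝ) (hp : ∀ i, 0 < p i) (hsum : ∑ i, p i = 1)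
    (hlam : ∀ i, 0 < lam i) (hne : ∃ i j, lam i ≠ lam j)
    (z : ℝ) (hz : 0 < z) :
    (∑ i, p i * Real.exp (-(lam i) * z)) *
        (∫ t in Set.Ioi (0 : ℝ), ∑ i, p i * Real.exp (-(lam i) * t))
      < ∫ t in Set.Ioi z, ∑ i, p i * Real.exp (-(lam i) * t) := by
  have hI : ∀ c : ℝ, (∫ t in Set.Ioi c, ∑ i, p i * Real.exp (-(lam i) * t))
      = ∑ i, p i * (Real.exp (-(lam i) * c) * (lam i)⁻¹) := by
    intro c
    rw [integral_finsetSum]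
    · refine Finset.sum_congr rfl fun i _ => ?_
      rw [integral_const_mul, integral_exp_mul_Ioi (by linarith [hlam i])]
      rw [neg_div_neg_eq, div_eq_mul_inv]
    · intro i _
      exact (integrableOn_exp_mul_Ioi (by linarith [hlam i]) c).const_mul _
  rw [hI, hI]
  simp only [mul_zero, Real.exp_zero, one_mul]
  have hexp : ∀ i j, lam i < lam j →
      0 < (Real.exp (-(lam i) * z) - Real.exp (-(lam j) * z)) * ((lam i)⁻¹ - (lam j)⁻¹) := by
    intro i j h
    apply mul_pos
    · rw [sub_pos, Real.exp_lt_exp]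
      nlinarith
    · rw [sub_pos]
      exact inv_strictAnti₀ (hlam i) h
  generalize hE : (fun i => Real.exp (-(lam i) * z)) = e at *
  have he : ∀ i, Real.exp (-(lam i) * z) = e i := fun i => congrFun hE i
  simp only [he] at *
  have hpos : ∀ i j, lam i ≠ lam j → 0 < p i * p j * ((e i - e j) * ((lam i)⁻¹ - (lam j)⁻¹)) := by
    intro i j h
    refine mul_pos (mul_pos (hp i) (hp j)) ?_
    rcases lt_or_gt_of_ne h with h | h
    · exact hexp i j h
    · have := hexp j i h
      linarith
  have hnn : ∀ i j, 0 ≤ p i * p j * ((e i - e j) * ((lam i)⁻¹ - (lam j)⁻¹)) := by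
    intro i j
    by_cases h : lam i = lam j
    · simp [h]
    · exact (hpos i j h).le
  obtain ⟨a, b, hab⟩ := hne
  have hS : 0 < ∑ i, ∑ j, p i * p j * ((e i - e j) * ((lam i)⁻¹ - (lam j)⁻¹)) :=
    Finset.sum_pos' (fun i _ => Finset.sum_nonneg fun j _ => hnn i j)
      ⟨a, Finset.mem_univ _, Finset.sum_pos' (fun j _ => hnn a j)
        ⟨b, Finset.mem_univ _, hpos a b hab⟩⟩
  have hEq : ∑ i, ∑ j, p i * p j * ((e i - e j) * ((lam i)⁻¹ - (lam j)⁻¹))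
      = (∑ i, p i * (e i * (lam i)⁻¹)) * (∑ i, p i) + (∑ i, p i) * (∑ i, p i * (e i * (lam i)⁻¹))
        - (∑ i, p i * e i) * (∑ i, p i * (lam i)⁻¹)
        - (∑ i, p i * (lam i)⁻¹) * (∑ i, p i * e i) := by
    simp only [Finset.sum_mul_sum, ← Finset.sum_add_distrib, ← Finset.sum_sub_distrib]
    refine Finset.sum_congr rfl fun i _ => Finset.sum_congr rfl fun j _ => ?_
    ring
  rw [hEq, hsum] at hS
  linarith
end

section
/- Let S be a Pareto random variable with shape α > 1 and scale s_m > 0, i.e. with complementary CDF F̄(t) = 1 for t < s_m and F̄(t) = (s_m/t)^α for t ≥ s_m. Then for every z ≥ 0, the strict inequality E[min(S, z)] < P(S ≤ z)·E[S] holds if and only if z > α·s_m; i.e., the set of timeouts satisfying the capacity-gain condition is exactly the interval (α·s_m, ∞). -/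
open MeasureTheory Set

/-- **Pareto slowdown.** Let `S` be Pareto with shape `α > 1` and scale
`s_m > 0`, i.e. with complementary CDF `F̄(t) = 1` for `t < s_m` and `F̄(t) = (s_m/t)^α`
for `t ≥ s_m`. Then for every `z ≥ 0`, the capacity-gain condition
`E[min(S, z)] < P(S ≤ z)·E[S]` holds if and only if `z > α·s_m`. -/
theorem pareto_capacity_gain_iff {Ω : Type*} [MeasurableSpace Ω]
    (P : Measure Ω) [IsProbabilityMeasure P]
    (S : Ω → ℝ) (hmS : Measurable S)
    (α s_m : ℝ) (hα : 1 < α) (hsm : 0 < s_m)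
    (hccdf : ∀ t : ℝ, (P {ω | t < S ω}).toReal
      = if t < s_m then 1 else (s_m / t) ^ α)
    (z : ℝ) (hz : 0 ≤ z) :
    ((∫ ω, min (S ω) z ∂P) < (P {ω | S ω ≤ z}).toReal * ∫ ω, S ω ∂P)
      ↔ α * s_m < z := by
  have hG : ∀ t : ℝ, P.real {ω | t < S ω} = if t < s_m then 1 else (s_m / t) ^ α := hccdf
  have hle : (P {ω | S ω ≤ z}).toReal = 1 - P.real {ω | z < S ω} := by
    have h := probReal_compl_eq_one_sub (μ := P) (measurableSet_lt (measurable_const (a := z)) hmS)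
    rw [← h, measureReal_def]
    congr 2
    ext ω
    simp
  have hnn : 0 ≤ᵐ[P] S := by
    have h0 : P {ω | 0 < S ω} = 1 := by
      have := hccdf 0
      rw [if_pos hsm] at this
      rwa [ENNReal.toReal_eq_one_iff] at this
    have h1 : ∀ᵐ ω ∂P, 0 < S ω :=
      (prob_compl_eq_zero_iff (measurableSet_lt measurable_const hmS)).2 h0
    filter_upwards [h1] with ω h using h.le
  have hmin0 : 0 ≤ᵐ[P] fun ω => min (S ω) z := by
    filter_upwards [hnn] with ω h using le_min h hz
  have hEq : ∀ c, s_m ≤ c → EqOn (fun t => P.real {ω | t < S ω})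
      (fun t => s_m ^ α * t ^ (-α)) (Ioi c) := by
    intro c hc t ht
    have ht' : c < t := ht
    have ht0 : 0 < t := by linarith
    simp only [hG t]
    rw [if_neg (by linarith), Real.div_rpow hsm.le ht0.le, Real.rpow_neg ht0.le, div_eq_mul_inv]
  have hI : ∀ c, s_m ≤ c → IntegrableOn (fun t => P.real {ω | t < S ω}) (Ioi c) := by
    intro c hc
    rw [integrableOn_congr_fun (hEq c hc) measurableSet_Ioi]
    exact (integrableOn_Ioi_rpow_of_lt (by linarith) (by linarith)).const_mul _
  have hV : ∀ c, s_m ≤ c → ∫ t in Ioi c, P.real {ω | t < S ω} = (s_m / c) ^ α * c / (α - 1) := by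
    intro c hc
    have hc0 : 0 < c := by linarith
    rw [setIntegral_congr_fun measurableSet_Ioi (hEq c hc), integral_const_mul,
      integral_Ioi_rpow_of_lt (by linarith) hc0, Real.rpow_add hc0, Real.rpow_one,
      Real.div_rpow hsm.le hc0.le, Real.rpow_neg hc0.le]
    have h1 : α - 1 ≠ 0 := by linarith
    have h2 : -α + 1 ≠ 0 := by linarith
    have h3 := (Real.rpow_pos_of_pos hc0 α).ne'
    field_simp
    ring
  have hEq1 : EqOn (fun t => P.real {ω | t < S ω}) (fun _ => (1 : ℝ)) (Ioo 0 s_m) := by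
    intro t ht
    simp only [hG t]
    rw [if_pos ht.2]
  have hI1 : IntegrableOn (fun t => P.real {ω | t < S ω}) (Ioc 0 s_m) := by
    rw [integrableOn_Ioc_iff_integrableOn_Ioo, integrableOn_congr_fun hEq1 measurableSet_Ioo]
    simp
  have hV1 : ∫ t in Ioc 0 s_m, P.real {ω | t < S ω} = s_m := by
    rw [integral_Ioc_eq_integral_Ioo, setIntegral_congr_fun measurableSet_Ioo hEq1]
    simp [hsm.le]
  have hI0 : IntegrableOn (fun t => P.real {ω | t < S ω}) (Ioi 0) := by
    rw [← Ioc_union_Ioi_eq_Ioi hsm.le]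
    exact hI1.union (hI s_m le_rfl)
  have hSint : Integrable S P := by
    refine ⟨hmS.aestronglyMeasurable, ?_⟩
    rw [hasFiniteIntegral_iff_ofReal hnn, lintegral_eq_lintegral_meas_lt P hnn hmS.aemeasurable]
    have := hI0.lintegral_lt_top
    simpa using this
  have hsplit : ∀ c, 0 ≤ c → s_m ≤ c → ∫ t in Ioi 0, P.real {ω | t < S ω}
      = (∫ t in Ioc 0 c, P.real {ω | t < S ω}) + ∫ t in Ioi c, P.real {ω | t < S ω} := by
    intro c h0 hc
    rw [← Ioc_union_Ioi_eq_Ioi h0]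
    exact setIntegral_union (Ioc_disjoint_Ioi le_rfl) measurableSet_Ioi
      (hI0.mono_set Ioc_subset_Ioi_self) (hI c hc)
  have hES : ∫ ω, S ω ∂P = s_m + s_m / (α - 1) := by
    rw [hSint.integral_eq_integral_meas_lt hnn, hsplit s_m hsm.le le_rfl, hV1, hV s_m le_rfl,
      div_self hsm.ne', Real.one_rpow, one_mul]
  rw [hle, hG z]
  rcases lt_or_ge z s_m with h | h
  · rw [if_pos h]
    have h1 : 0 ≤ ∫ ω, min (S ω) z ∂P := integral_nonneg_of_ae hmin0
    constructor
    · intro h2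
      linarith
    · intro h2
      nlinarith
  · have hM : ∫ ω, min (S ω) z ∂P = ∫ t in Ioc 0 z, P.real {ω | t < S ω} := by
      have hmi : Integrable (fun ω => min (S ω) z) P := hSint.inf (integrable_const z)
      rw [hmi.integral_eq_integral_meas_lt hmin0,
        integral_Ioc_eq_integral_Ioo]
      have : ∀ t, P.real {ω | t < min (S ω) z}
          = (Iio z).indicator (fun t => P.real {ω | t < S ω}) t := by
        intro t
        by_cases ht : t < z
        · simp [ht]
        · simp [ht]
      simp_rw [this]
      rw [setIntegral_indicator measurableSet_Iio, Ioi_inter_Iio]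
    have hz0 : 0 < z := by linarith
    have e := hsplit z hz h
    rw [← hSint.integral_eq_integral_meas_lt hnn, ← hM, hV z h] at e
    rw [if_neg (by linarith)]
    have hp : 0 < (s_m / z) ^ α := Real.rpow_pos_of_pos (div_pos hsm hz0) α
    set p := (s_m / z) ^ α
    have ha : 0 < α - 1 := by linarith
    have key : (1 - p) * ∫ ω, S ω ∂P = (∫ ω, min (S ω) z ∂P) + p / (α - 1) * (z - α * s_m) := by
      have : (∫ ω, min (S ω) z ∂P) = s_m + s_m / (α - 1) - p * z / (α - 1) := by
        rw [← hES]; linarith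
      rw [this, hES]
      field_simp
      ring
    rw [key, lt_add_iff_pos_right, mul_pos_iff_of_pos_left (div_pos hp ha), sub_pos]
end

section
/- Let k ≥ 1 be an integer, λ > 0, and let F̄(z) := exp(−λ·z)·Σ_{n=0}^{k−1} (λ·z)^n / n! be the complementary CDF of the Erlang(k, λ) distribution. Then for every z ≥ 0: ∫_z^∞ F̄(t) dt ≤ (k/λ)·F̄(z). Equivalently, an Erlang-distributed random variable S satisfies E[min(S, z)] ≥ P(S ≤ z)·E[S] for every z ≥ 0, so no timeout satisfies the capacity-gain condition and speculation cannot increase the stability region. -/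
open MeasureTheory Set

lemma erl_aux1 (l : ℝ) (k : ℕ) (t : ℝ) :
    HasDerivAt (fun t : ℝ => Real.exp (-(l * t)) *
      ∑ n ∈ Finset.range (k+1), (l * t) ^ n / (n.factorial : ℝ))
      (-l * (Real.exp (-(l * t)) * ((l * t) ^ k / (k.factorial : ℝ)))) t := by
  have hl : HasDerivAt (fun t : ℝ => l * t) l t := by
    simpa using (hasDerivAt_id t).const_mul l
  have he := hl.neg.exp
  induction k with
  | zero =>
    simp only [zero_add, Finset.sum_range_one, pow_zero, Nat.factorial_zero, Nat.cast_one,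
      div_one, mul_one]
    exact he.congr_deriv (by simp only [Pi.neg_apply]; ring)
  | succ k ih =>
    have h2 := he.mul ((hl.pow (k+1)).div_const ((k+1).factorial : ℝ))
    have h3 := ih.add h2
    refine (h3.congr_deriv ?_).congr_of_eventuallyEq (Filter.Eventually.of_forall fun s => ?_)
    · have : (k.factorial : ℝ) ≠ 0 := by positivity
      simp only [Nat.factorial_succ, Pi.neg_apply, Pi.pow_apply]
      push_cast
      field_simp
      simp
    · simp only [Pi.add_apply, Pi.mul_apply, Pi.neg_apply, Pi.pow_apply]
      rw [Finset.sum_range_succ _ (k+1)]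
      ring

lemma erl_aux2 (l : ℝ) (hl : l ≠ 0) (k : ℕ) (t : ℝ) :
    HasDerivAt (fun t : ℝ => -(1 / l) * (Real.exp (-(l * t)) *
      ∑ n ∈ Finset.range k, ((k:ℝ) - n) * ((l * t) ^ n / (n.factorial : ℝ))))
      (Real.exp (-(l * t)) * ∑ n ∈ Finset.range k, (l * t) ^ n / (n.factorial : ℝ)) t := by
  induction k with
  | zero => simpa using hasDerivAt_const t (0:ℝ)
  | succ k ih =>
    have h3 := ih.add ((erl_aux1 l k t).const_mul (-(1 / l)))
    refine (h3.congr_deriv ?_).congr_of_eventuallyEq (Filter.Eventually.of_forall fun s => ?_)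
    · rw [Finset.sum_range_succ _ k]
      field_simp
    · simp only [Pi.add_apply]
      rw [← mul_add, ← mul_add]
      congr 2
      rw [Finset.sum_range_succ, Finset.sum_range_succ, ← add_assoc, ← Finset.sum_add_distrib]
      push_cast
      congr 1
      · exact Finset.sum_congr rfl fun n _ => by ring
      · ring

lemma erl_aux3 (l : ℝ) (hl : 0 < l) (k : ℕ) :
    Filter.Tendsto (fun t : ℝ => -(1 / l) * (Real.exp (-(l * t)) *
      ∑ n ∈ Finset.range k, ((k:ℝ) - n) * ((l * t) ^ n / (n.factorial : ℝ))))
      Filter.atTop (nhds 0) := by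
  have h : Filter.Tendsto (fun x : ℝ => -(1 / l) * 
      ∑ n ∈ Finset.range k, (((k:ℝ) - n) / (n.factorial : ℝ)) * (x ^ n * Real.exp (-x)))
      Filter.atTop (nhds (-(1 / l) * ∑ n ∈ Finset.range k,
        (((k:ℝ) - n) / (n.factorial : ℝ)) * 0)) :=
    (tendsto_finsetSum _ fun n _ =>
      (Real.tendsto_pow_mul_exp_neg_atTop_nhds_zero n).const_mul _).const_mul _
  simp only [mul_zero, Finset.sum_const_zero] at h
  refine (h.comp (Filter.tendsto_id.const_mul_atTop hl)).congr fun t => ?_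
  simp only [Function.comp, id]
  rw [Finset.mul_sum (a := Real.exp _)]
  congr 1
  exact Finset.sum_congr rfl fun n _ => by ring

/-- **Erlang slowdown.** For the Erlang(`k`, `λ`) complementary CDF
`F̄(z) = exp(−λz)·∑_{n<k} (λz)^n/n!`, one has `∫_z^∞ F̄(t) dt ≤ (k/λ)·F̄(z)` for every
`z ≥ 0`; i.e. `E[min(S,z)] ≥ P(S ≤ z)·E[S]` always holds and no timeout satisfies the
capacity-gain condition. -/
theorem erlang_no_capacity_gain (k : ℕ) (hk : 1 ≤ k) (lam : ℝ) (hlam : 0 < lam)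
    (z : ℝ) (hz : 0 ≤ z) :
    (∫ t in Set.Ioi z,
        Real.exp (-(lam * t)) * ∑ n ∈ Finset.range k, (lam * t) ^ n / (n.factorial : ℝ))
      ≤ (k / lam) *
        (Real.exp (-(lam * z)) * ∑ n ∈ Finset.range k, (lam * z) ^ n / (n.factorial : ℝ)) := by
  rw [integral_Ioi_of_hasDerivAt_of_nonneg' (fun t _ => erl_aux2 lam hlam.ne' k t) ?_
    (erl_aux3 lam hlam k)]
  · rw [zero_sub, neg_mul, neg_neg, div_eq_mul_one_div (k:ℝ), mul_comm (k:ℝ), mul_assoc,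
      mul_left_comm (k:ℝ), Finset.mul_sum (a := (k:ℝ))]
    gcongr with n _
    simp
  · intro t ht
    have : 0 < t := lt_of_le_of_lt hz ht
    positivity
end

section
/- Assume the hazard rate h(t) := f₁(t)/F̄₁(t) is nonincreasing on [0,∞) and that r(t) := (1 + η̄₂'(t))/η̄₂(t) is nondecreasing on [0,∞). Suppose the stopping set 𝒮 := { τ ≥ 0 : h(τ) ≤ r(τ) } is nonempty and let τ* := inf 𝒮. Then τ* belongs to 𝒮 and τ* is a global minimizer of the (rescaled) load: g(τ*) ≤ g(τ) for every τ ≥ 0, where g(τ) := ∫_0^τ F̄₁(t) dt + η̄₂(τ)·F̄₁(τ). -/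
open MeasureTheory Set

/-- Complementary CDF `F̄₁(t) = ∫_t^∞ f₁(s) ds`. -/
noncomputable def Fbar (f₁ : ℝ → ℝ) (t : ℝ) : ℝ := ∫ s in Set.Ioi t, f₁ s

/-- The (rescaled) load `g(τ) = ∫_0^τ F̄₁(t) dt + η̄₂(τ)·F̄₁(τ) = ρ(τ)/λ`. -/
noncomputable def load (f₁ ηb₂ : ℝ → ℝ) (τ : ℝ) : ℝ :=
  (∫ t in (0 : ℝ)..τ, Fbar f₁ t) + ηb₂ τ * Fbar f₁ τ

/-- The stopping set `𝒮 = {τ ≥ 0 : h(τ) ≤ r(τ)}`, where `h = f₁/F̄₁` is the hazard rate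
and `r = (1 + η̄₂')/η̄₂`. -/
def stopSet (f₁ ηb₂ ηb₂' : ℝ → ℝ) : Set ℝ :=
  {τ : ℝ | 0 ≤ τ ∧ f₁ τ / Fbar f₁ τ ≤ (1 + ηb₂' τ) / ηb₂ τ}

/-- **Theorem 5, optimal timeout.** Assume the hazard rate `h = f₁/F̄₁` is
nonincreasing on `[0,∞)` and `r = (1 + η̄₂')/η̄₂` is nondecreasing on `[0,∞)`. If the
stopping set `𝒮 = {τ ≥ 0 : h(τ) ≤ r(τ)}` is nonempty, then `τ* = inf 𝒮` belongs to `𝒮`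
and is a global minimizer of the load `g`. -/
theorem optimal_timeout (f₁ ηb₂ ηb₂' : ℝ → ℝ)
    (hf_cont : ContinuousOn f₁ (Ici 0))
    (hf_nonneg : ∀ t, 0 ≤ t → 0 ≤ f₁ t)
    (hf_one : (∫ t in Set.Ioi (0 : ℝ), f₁ t) = 1)
    (hF_pos : ∀ t, 0 ≤ t → 0 < Fbar f₁ t)
    (hη_pos : ∀ t, 0 ≤ t → 0 < ηb₂ t)
    (hη_deriv : ∀ t, 0 ≤ t → HasDerivAt ηb₂ (ηb₂' t) t)
    (hη'_cont : ContinuousOn ηb₂' (Ici 0))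
    (hhaz : AntitoneOn (fun t => f₁ t / Fbar f₁ t) (Ici 0))
    (hr : MonotoneOn (fun t => (1 + ηb₂' t) / ηb₂ t) (Ici 0))
    (hS : (stopSet f₁ ηb₂ ηb₂').Nonempty) :
    sInf (stopSet f₁ ηb₂ ηb₂') ∈ stopSet f₁ ηb₂ ηb₂' ∧
      ∀ τ, 0 ≤ τ → load f₁ ηb₂ (sInf (stopSet f₁ ηb₂ ηb₂')) ≤ load f₁ ηb₂ τ := by
  have hint : IntegrableOn f₁ (Ioi 0) := by
    by_contra h
    rw [integral_undef h] at hf_one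
    exact zero_ne_one hf_one
  set φ : ℝ → ℝ := fun t => f₁ (max t 0) with hφ
  have hφc : Continuous φ :=
    hf_cont.comp_continuous (by fun_prop) (fun x => by simp)
  have hφe : ∀ t, 0 ≤ t → φ t = f₁ t := fun t ht => by simp [hφ, max_eq_left ht]
  set G : ℝ → ℝ := fun t => 1 - ∫ s in (0 : ℝ)..t, φ s with hG
  have hGd : ∀ t, HasDerivAt G (-φ t) t := fun t =>
    (hφc.integral_hasStrictDerivAt 0 t).hasDerivAt.const_sub 1
  have hGc : Continuous G := continuous_iff_continuousAt.2 fun t => (hGd t).continuousAt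
  have hFG : ∀ t, 0 ≤ t → Fbar f₁ t = G t := by
    intro t ht
    have h1 : (∫ s in (0 : ℝ)..t, φ s) = ∫ s in (0 : ℝ)..t, f₁ s := by
      apply intervalIntegral.integral_congr
      intro s hs
      rw [uIcc_of_le ht] at hs
      exact hφe s hs.1
    have h2 := intervalIntegral.integral_interval_add_Ioi (μ := volume) (f := f₁) hint
      (hint.mono_set (Ioi_subset_Ioi ht))
    simp only [hG, Fbar, h1]
    linarith
  set L : ℝ → ℝ := fun t => (∫ s in (0 : ℝ)..t, G s) + ηb₂ t * G t with hL
  have hLe : ∀ t, 0 ≤ t → load f₁ ηb₂ t = L t := by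
    intro t ht
    have h1 : (∫ s in (0 : ℝ)..t, Fbar f₁ s) = ∫ s in (0 : ℝ)..t, G s := by
      apply intervalIntegral.integral_congr
      intro s hs
      rw [uIcc_of_le ht] at hs
      exact hFG s hs.1
    simp only [load, hL, h1, hFG t ht]
  have hLd : ∀ t, 0 ≤ t → HasDerivAt L (G t + (ηb₂' t * G t + ηb₂ t * (-φ t))) t := fun t ht =>
    (hGc.integral_hasStrictDerivAt 0 t).hasDerivAt.add ((hη_deriv t ht).mul (hGd t))
  have hLc : ContinuousOn L (Ici 0) := fun t ht => (hLd t ht).continuousAt.continuousWithinAt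
  have hGpos : ∀ t, 0 ≤ t → 0 < G t := fun t ht => hFG t ht ▸ hF_pos t ht
  have hsgn : ∀ t, 0 ≤ t → (f₁ t / Fbar f₁ t ≤ (1 + ηb₂' t) / ηb₂ t ↔
      0 ≤ G t + (ηb₂' t * G t + ηb₂ t * (-φ t))) := by
    intro t ht
    rw [hFG t ht, hφe t ht, div_le_div_iff₀ (hGpos t ht) (hη_pos t ht)]
    constructor <;> intro h <;> linarith
  have hηc : ContinuousOn ηb₂ (Ici 0) :=
    fun t ht => (hη_deriv t ht).continuousAt.continuousWithinAt
  set S := stopSet f₁ ηb₂ ηb₂' with hSdef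
  have hSeq : S = {t ∈ Ici (0 : ℝ) | (fun _ => (0 : ℝ)) t ≤
      (fun t => G t + (ηb₂' t * G t + ηb₂ t * (-φ t))) t} := by
    ext t
    constructor
    · rintro ⟨h0, h1⟩
      exact ⟨h0, (hsgn t h0).1 h1⟩
    · rintro ⟨h0, h1⟩
      exact ⟨h0, (hsgn t h0).2 h1⟩
  have hcl : IsClosed S := by
    rw [hSeq]
    apply isClosed_Ici.isClosed_le continuousOn_const
    exact hGc.continuousOn.add ((hη'_cont.mul hGc.continuousOn).add
      (hηc.mul hφc.neg.continuousOn))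
  have hbdd : BddBelow S := ⟨0, fun t ht => ht.1⟩
  have hmem : sInf S ∈ S := hcl.csInf_mem hS hbdd
  refine ⟨hmem, ?_⟩
  set a := sInf S with ha
  have ha0 : 0 ≤ a := hmem.1
  intro τ hτ
  rw [hLe a ha0, hLe τ hτ]
  rcases le_total τ a with h | h
  · have : AntitoneOn L (Icc 0 a) := by
      apply antitoneOn_of_deriv_nonpos (convex_Icc 0 a) (hLc.mono Icc_subset_Ici_self)
      · intro t ht
        rw [interior_Icc] at ht
        exact (hLd t ht.1.le).differentiableAt.differentiableWithinAt
      · intro t ht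
        rw [interior_Icc] at ht
        rw [(hLd t ht.1.le).deriv]
        by_contra hc
        have : t ∈ S := ⟨ht.1.le, (hsgn t ht.1.le).2 (not_le.1 hc).le⟩
        exact absurd (csInf_le hbdd this) (not_le.2 ht.2)
    exact this ⟨hτ, h⟩ ⟨ha0, le_rfl⟩ h
  · have : MonotoneOn L (Ici a) := by
      apply monotoneOn_of_deriv_nonneg (convex_Ici a) (hLc.mono (Ici_subset_Ici.2 ha0))
      · intro t ht
        rw [interior_Ici] at ht
        exact (hLd t (ha0.trans (le_of_lt ht))).differentiableAt.differentiableWithinAt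
      · intro t ht
        rw [interior_Ici] at ht
        have hat : a ≤ t := le_of_lt ht
        have ht0 : 0 ≤ t := ha0.trans hat
        rw [(hLd t ht0).deriv]
        exact (hsgn t ht0).1 ((hhaz ha0 ht0 hat).trans (hmem.2.trans (hr ha0 ht0 hat)))
    exact this self_mem_Ici h h
end
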